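/- Let λ = (λ_1, …, λ_n) ∈ Γ_k ⊆ ℝ^n with 1 ≤ k ≤ n, and suppose λ_1 < 0 is the smallest entry of λ (λ_1 ≤ λ_i for all i). Then Σ_{i=1}^n S_{k−1}(λ|i) ≥ (−λ_1)^{k−1}; that is, Σ_{i=1}^n ∂S_k/∂λ_i ≥ (−λ_1)^{k−1}. -/

import Mathlib

open Finset

noncomputable section

/-- The `k`-th elementary symmetric function of a finite family of reals. -/
def S {ι : Type*} [Fintype ι] (k : ℕ) (lam : ι → ℝ) : ℝ :=
  ∑ s ∈ Finset.univ.powersetCard k, ∏ i ∈ s, lam i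

/-- The Gårding cone `Γ_k` in `ℝ^ι`. -/
def Gamma (ι : Type*) [Fintype ι] (k : ℕ) : Set (ι → ℝ) :=
  {lam | ∀ i : ℕ, 1 ≤ i → i ≤ k → 0 < S i lam}

/-- Increasing multi-indices of length `m` from `{1,…,n}`, i.e. `m`-element subsets of `Fin n`. -/
abbrev MIdx (n m : ℕ) := {s : Finset (Fin n) // s.card = m}

/-- The vector of all `m`-fold sums of the entries of `μ`. -/
def sumVec (n m : ℕ) (μ : Fin n → ℝ) : MIdx n m → ℝ := fun s => ∑ i ∈ s.1, μ i

/-- The generalized Gårding cone `Γ_k^{(m)}`. -/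
def GammaGen (n m k : ℕ) : Set (Fin n → ℝ) :=
  {μ | sumVec n m μ ∈ Gamma (MIdx n m) k}

/-- The `W`-matrix of a symmetric `n × n` matrix `A`. -/
def Wmat {n : ℕ} (m : ℕ) (A : Matrix (Fin n) (Fin n) ℝ) :
    Matrix (MIdx n m) (MIdx n m) ℝ := fun α β =>
  if α = β then ∑ i ∈ α.1, A i i
  else if (α.1 \ β.1).card = 1 then
    ∑ i ∈ α.1 \ β.1, ∑ j ∈ β.1 \ α.1,
      (-1 : ℝ) ^ (Nat.dist ((α.1.filter (fun a => a < i)).card)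
                           ((β.1.filter (fun b => b < j)).card)) * A i j
  else 0

/-- `S_k` of a matrix, as the sum of its `k × k` principal minors
(equal to `S_k` of the eigenvalues for symmetric matrices). -/
def Smat {ι : Type*} [Fintype ι] [DecidableEq ι] (k : ℕ) (M : Matrix ι ι ℝ) : ℝ :=
  ∑ s ∈ Finset.univ.powersetCard k,
    (M.submatrix (Subtype.val : {x // x ∈ s} → ι) (Subtype.val : {x // x ∈ s} → ι)).det

abbrev E (n : ℕ) := EuclideanSpace ℝ (Fin n)

/-- The Hessian matrix of `u` at `x`. -/
def hess (n : ℕ) (u : E n → ℝ) (x : E n) : Matrix (Fin n) (Fin n) ℝ :=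
  fun i j => iteratedFDeriv ℝ 2 u x ![EuclideanSpace.single i 1, EuclideanSpace.single j 1]


open Polynomial in
theorem Polynomial.Splits.derivative_real {p : ℝ[X]} (hp : p.Splits) : (derivative p).Splits := by
  have h₁ := splits_iff_card_roots.1 hp
  have h₂ := card_roots_le_derivative p
  have h₃ := card_roots' (derivative p)
  have h₄ := natDegree_derivative_le p
  by_cases h₀ : p.natDegree = 0
  · exact Splits.of_natDegree_eq_zero (by omega)
  · exact splits_iff_card_roots.2 (by omega)

open Polynomial in
theorem Polynomial.Splits.two_mul_coeff_le_sq {p : ℝ[X]} (hp : p.Splits) :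
    2 * p.coeff 0 * p.coeff 2 ≤ p.coeff 1 ^ 2 := by
  obtain ⟨m, hm⟩ := splits_iff_exists_multiset.1 hp
  have key : 2 * (m.map fun a => X - C a).prod.coeff 0 * (m.map fun a => X - C a).prod.coeff 2 ≤
      (m.map fun a => X - C a).prod.coeff 1 ^ 2 := by
    clear hm
    induction m using Multiset.induction_on with
    | empty => simp [coeff_one]
    | cons a m ih =>
      rw [Multiset.map_cons, Multiset.prod_cons]
      generalize (m.map fun a => X - C a).prod = q at ih ⊢
      simp only [sub_mul, coeff_sub, coeff_C_mul, coeff_X_mul, coeff_X_mul_zero]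
      nlinarith [mul_le_mul_of_nonneg_left ih (sq_nonneg a), sq_nonneg (q.coeff 0)]
  rw [hm]
  simp only [coeff_C_mul]
  nlinarith [mul_le_mul_of_nonneg_left key (sq_nonneg p.leadingCoeff)]

open Polynomial in
/-- Newton's inequality for the coefficients of a real-rooted polynomial. -/
theorem Polynomial.Splits.newton_coeff {p : ℝ[X]} (hp : p.Splits) (m : ℕ) :
    (m + 2) * (p.coeff m * p.coeff (m + 2)) ≤ (m + 1) * p.coeff (m + 1) ^ 2 := by
  induction m generalizing p with
  | zero => simpa [mul_assoc] using hp.two_mul_coeff_le_sq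
  | succ m ih =>
    have h := ih hp.derivative_real
    simp only [coeff_derivative] at h
    push_cast at h ⊢
    have hpos : (0 : ℝ) < (m + 1) * (m + 2) := by positivity
    refine le_of_mul_le_mul_left ?_ hpos
    rw [show m + 1 + 2 = m + 2 + 1 from rfl]
    linear_combination h

theorem Polynomial.Splits.coeff_mul_coeff_le_sq {p : Polynomial ℝ} (hp : p.Splits) (m : ℕ) :
    p.coeff m * p.coeff (m + 2) ≤ p.coeff (m + 1) ^ 2 := by
  have h := hp.newton_coeff m
  have hm : (0 : ℝ) < m + 2 := by positivity
  nlinarith [sq_nonneg (p.coeff (m + 1))]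

section ElementarySymmetric

variable {ι : Type*} [Fintype ι]

open Polynomial in
theorem coeff_prod_one_add_C_mul_X (lam : ι → ℝ) (k : ℕ) :
    (∏ i, (1 + C (lam i) * X)).coeff k = S k lam := by
  simp only [S, Finset.prod_one_add, Finset.prod_mul_distrib, Finset.prod_const, ← map_prod,
    finsetSum_coeff, coeff_C_mul_X_pow, Finset.powersetCard_eq_filter, Finset.sum_filter, eq_comm]

open Polynomial in
theorem S_mul_S_le_sq (lam : ι → ℝ) (m : ℕ) : S m lam * S (m + 2) lam ≤ S (m + 1) lam ^ 2 := by
  simp only [← coeff_prod_one_add_C_mul_X]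
  refine Splits.coeff_mul_coeff_le_sq (Splits.prod fun i _ => Splits.of_natDegree_le_one ?_) m
  compute_degree

theorem S_zero (lam : ι → ℝ) : S 0 lam = 1 := by
  simp [S]

variable [DecidableEq ι]

open Polynomial in
theorem S_succ_eq_update (lam : ι → ℝ) (i : ι) (k : ℕ) :
    S (k + 1) lam =
      S (k + 1) (Function.update lam i 0) + lam i * S k (Function.update lam i 0) := by
  have h : ∏ j, (1 + C (lam j) * X) =
      (1 + C (lam i) * X) * ∏ j, (1 + C (Function.update lam i 0 j) * X) := by
    rw [← Finset.mul_prod_erase _ _ (Finset.mem_univ i),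
      ← Finset.mul_prod_erase _ (fun j => 1 + C (Function.update lam i 0 j) * X)
        (Finset.mem_univ i)]
    simp only [Function.update_self, map_zero, zero_mul, add_zero, one_mul]
    congr 1
    refine Finset.prod_congr rfl fun j hj => ?_
    rw [Function.update_of_ne (Finset.ne_of_mem_erase hj)]
  simp only [← coeff_prod_one_add_C_mul_X]
  rw [h, add_mul, one_mul, coeff_add, mul_assoc, coeff_C_mul, coeff_X_mul]

theorem S_update_pos_of_mem_Gamma {k : ℕ} {lam : ι → ℝ} (hG : lam ∈ Gamma ι k) (i : ι) {j : ℕ}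
    (hj : j < k) : 0 < S j (Function.update lam i 0) := by
  induction j with
  | zero => simp [S_zero]
  | succ j ih =>
    have hprev := ih (by omega)
    have h₁ := hG (j + 1) (by omega) (by omega)
    have h₂ := hG (j + 2) (by omega) (by omega)
    rw [S_succ_eq_update lam i] at h₁ h₂
    by_contra! hle
    rcases le_total (lam i) 0 with hi | hi
    · nlinarith
    · have hlc := S_mul_S_le_sq (Function.update lam i 0) j
      nlinarith

theorem pow_le_S_update_of_mem_Gamma {k : ℕ} {lam : ι → ℝ} (hG : lam ∈ Gamma ι k) {i : ι}
    (hi : lam i ≤ 0) {j : ℕ} (hj : j ≤ k) : (-lam i) ^ j ≤ S j (Function.update lam i 0) := by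
  induction j with
  | zero => simp [S_zero]
  | succ j ih =>
    have h := hG (j + 1) (by omega) hj
    rw [S_succ_eq_update lam i] at h
    rw [pow_succ']
    nlinarith [mul_le_mul_of_nonneg_left (ih (by omega)) (neg_nonneg.2 hi)]

end ElementarySymmetric

/-- If `λ ∈ Γ_k` and `λ_1 < 0` is the smallest entry, then
`Σ_i S_{k-1}(λ|i) ≥ (-λ_1)^{k-1}`. -/
theorem stmt11 (n k : ℕ) (hk1 : 1 ≤ k) (hkn : k ≤ n)
    (lam : Fin n → ℝ) (hG : lam ∈ Gamma (Fin n) k)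
    (hneg : lam ⟨0, by omega⟩ < 0) (hmin : ∀ i : Fin n, lam ⟨0, by omega⟩ ≤ lam i) :
    (-lam ⟨0, by omega⟩) ^ (k-1) ≤ ∑ i : Fin n, S (k-1) (Function.update lam i 0) := by
  exact (pow_le_S_update_of_mem_Gamma hG hneg.le (by omega)).trans
    (Finset.single_le_sum (f := fun i => S (k - 1) (Function.update lam i 0))
      (fun i _ => (S_update_pos_of_mem_Gamma hG i (by omega)).le) (Finset.mem_univ _))
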